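/- Two n-linear forms F and G (n ≥ 2) on finite-dimensional complex vector spaces U and V are congruent if and only if the systems of n-linear forms S(F) = {F^σ : σ ∈ S_n} and S(G) = {G^σ : σ ∈ S_n} are equivalent, i.e., if and only if there exist linear bijections φ₁,…,φₙ : U → V such that F^σ(u₁,…,uₙ) = G^σ(φ₁u₁,…,φₙuₙ) for every permutation σ ∈ S_n and all u₁,…,uₙ ∈ U. -/

import Mathlib

section Defs

variable {K : Type*} [Field K] {n : ℕ}

/-- The restriction of a multilinear form to a submodule. -/
def formRestrict {U : Type*} [AddCommGroup U] [Module K U]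
    (F : MultilinearMap K (fun _ : Fin n => U) K) (W : Submodule K U) :
    MultilinearMap K (fun _ : Fin n => W) K :=
  F.compLinearMap fun _ => W.subtype

/-- Two multilinear forms are congruent if a single linear bijection carries one to the other. -/
def FormCongruent {U V : Type*} [AddCommGroup U] [Module K U] [AddCommGroup V] [Module K V]
    (F : MultilinearMap K (fun _ : Fin n => U) K)
    (G : MultilinearMap K (fun _ : Fin n => V) K) : Prop :=
  ∃ φ : U ≃ₗ[K] V, ∀ u : Fin n → U, F u = G fun i => φ (u i)

/-- Symmetric equivalence of multilinear forms. -/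
def FormSymmEquiv {U V : Type*} [AddCommGroup U] [Module K U] [AddCommGroup V] [Module K V]
    (F : MultilinearMap K (fun _ : Fin n => U) K)
    (G : MultilinearMap K (fun _ : Fin n => V) K) : Prop :=
  ∃ φ : Fin n → U ≃ₗ[K] V, ∀ (σ : Equiv.Perm (Fin n)) (u : Fin n → U),
    F u = G fun i => φ (σ i) (u i)

/-- `W` is a direct-sum decomposition of the underlying space for which `F` vanishes on
mixed tuples, i.e. `F = ⨁ᵢ F|Wᵢ`. -/
def IsDecompFamily {U : Type*} [AddCommGroup U] [Module K U] {ι : Type*} [DecidableEq ι]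
    (F : MultilinearMap K (fun _ : Fin n => U) K) (W : ι → Submodule K U) : Prop :=
  DirectSum.IsInternal W ∧
    ∀ (x : Fin n → U) (k l : Fin n) (i j : ι), i ≠ j → x k ∈ W i → x l ∈ W j → F x = 0

/-- A multilinear form is indecomposable if in every direct-sum decomposition one of the
two subspaces is zero. -/
def FormIndecomposable {U : Type*} [AddCommGroup U] [Module K U]
    (F : MultilinearMap K (fun _ : Fin n => U) K) : Prop :=
  ∀ W₁ W₂ : Submodule K U, IsCompl W₁ W₂ →
    (∀ (x : Fin n → U) (k l : Fin n), x k ∈ W₁ → x l ∈ W₂ → F x = 0) →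
    W₁ = ⊥ ∨ W₂ = ⊥

/-- A multilinear form has no zero direct summands if in every direct-sum decomposition the
summand that is the zero form corresponds to the zero subspace. -/
def FormNoZeroSummand {U : Type*} [AddCommGroup U] [Module K U]
    (F : MultilinearMap K (fun _ : Fin n => U) K) : Prop :=
  ∀ W₁ W₂ : Submodule K U, IsCompl W₁ W₂ →
    (∀ (x : Fin n → U) (k l : Fin n), x k ∈ W₁ → x l ∈ W₂ → F x = 0) →
    (∀ x : Fin n → U, (∀ k, x k ∈ W₂) → F x = 0) → W₂ = ⊥

/-- A linear map `τ` is `G`-selfadjoint if applying `τ` in any one argument of `G`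
gives the same value regardless of the argument chosen. -/
def FormSelfAdjoint {V : Type*} [AddCommGroup V] [Module K V]
    (G : MultilinearMap K (fun _ : Fin n => V) K) (τ : V →ₗ[K] V) : Prop :=
  ∀ (v : Fin n → V) (i j : Fin n),
    G (Function.update v i (τ (v i))) = G (Function.update v j (τ (v j)))

end Defs

open Polynomial in
/-- A polynomial vanishing at all roots of the minimal polynomial of `t` is nilpotent at `t`. -/
theorem isNilpotent_aeval_of_isRoot_minpoly {K A : Type*} [Field K] [IsAlgClosed K] [Ring A]
    [Algebra K A] {t : A} (ht : IsIntegral K t) {r : K[X]}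
    (hr : ∀ a, (minpoly K t).IsRoot a → r.IsRoot a) : IsNilpotent (aeval t r) := by
  have hdvd : minpoly K t ∣ r ^ (minpoly K t).roots.card := by
    conv_lhs => rw [(IsAlgClosed.splits (minpoly K t)).eq_prod_roots_of_monic (minpoly.monic ht)]
    rw [← Multiset.prod_replicate, ← Multiset.map_const']
    exact Multiset.prod_dvd_prod_of_dvd _ _ fun a ha =>
      dvd_iff_isRoot.2 (hr a (isRoot_of_mem_roots ha))
  refine ⟨(minpoly K t).roots.card, ?_⟩
  rw [← map_pow]
  exact aeval_eq_zero_of_dvd_aeval_eq_zero hdvd (minpoly.aeval K t)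

open Polynomial in
theorem IsUnit.exists_pow_eq_of_isAlgClosed (K : Type*) {A : Type*} [Field K] [IsAlgClosed K]
    [CommRing A] [Algebra K A] {t : A} (hint : IsIntegral K t) (ht : IsUnit t) {m : ℕ}
    (hm : (m : K) ≠ 0) : ∃ r : A, r ^ m = t := by
  classical
  have hm0 : m ≠ 0 := by
    rintro rfl
    simp at hm
  choose ρ hρ using fun a : K => IsAlgClosed.exists_pow_nat_eq a (Nat.pos_of_ne_zero hm0)
  set q := Lagrange.interpolate (minpoly K t).roots.toFinset id ρ with hq
  have hnil : IsNilpotent (aeval t q ^ m - t) := by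
    have h := isNilpotent_aeval_of_isRoot_minpoly hint (r := q ^ m - X) fun a ha => by
      have hmem : a ∈ (minpoly K t).roots.toFinset := by
        rw [Multiset.mem_toFinset, mem_roots (minpoly.ne_zero hint)]
        exact ha
      have heval : q.eval a = ρ a :=
        Lagrange.eval_interpolate_at_node ρ Function.injective_id.injOn hmem
      simp [heval, hρ]
    simpa using h
  have hunit : IsUnit (aeval t q) := by
    rw [← isUnit_pow_iff hm0]
    simpa using hnil.isUnit_add_right_of_commute ht (Commute.all _ _)
  have hmA : IsUnit (m : A) := by
    simpa using (IsUnit.mk0 _ hm).map (algebraMap K A)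
  obtain ⟨r, ⟨-, hr⟩, -⟩ := existsUnique_nilpotent_sub_and_aeval_eq_zero
    (P := (X ^ m - C t : A[X])) (x := aeval t q) (by simpa using hnil)
    (by simpa [derivative_X_pow] using hmA.mul (hunit.pow (m - 1)))
  exact ⟨r, by simpa [sub_eq_zero] using hr⟩

theorem IsUnit.exists_mem_adjoin_pow_eq_of_isAlgClosed (K : Type*) {A : Type*} [Field K]
    [IsAlgClosed K] [Ring A] [Algebra K A] {t : A} (hint : IsIntegral K t) (ht : IsUnit t)
    {m : ℕ} (hm : (m : K) ≠ 0) : ∃ r ∈ Algebra.adjoin K {t}, r ^ m = t := by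
  let t' : Algebra.adjoin K {t} := ⟨t, Algebra.self_mem_adjoin_singleton K t⟩
  have hint' : IsIntegral K t' :=
    (isIntegral_algHom_iff (Algebra.adjoin K {t}).val Subtype.val_injective).1 hint
  have ht' : IsUnit t' := by
    refine IsArtinianRing.isUnit_of_isIntegral_of_nonZeroDivisor (R := K) hint' ?_
    rw [mem_nonZeroDivisors_iff_right]
    intro x hx
    have hx' : (x : A) * t = 0 := congrArg Subtype.val hx
    exact Subtype.ext (ht.mul_left_eq_zero.1 hx')
  obtain ⟨r, hr⟩ := ht'.exists_pow_eq_of_isAlgClosed K hint' hm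
  exact ⟨r, r.2, congrArg Subtype.val hr⟩

section FormSelfAdjoint

variable {K : Type*} [Field K] {n : ℕ} {V : Type*} [AddCommGroup V] [Module K V]
  {G : MultilinearMap K (fun _ : Fin n => V) K}

theorem FormSelfAdjoint.one : FormSelfAdjoint G 1 := by
  intro v i j
  simp

theorem FormSelfAdjoint.add {ρ τ : Module.End K V} (hρ : FormSelfAdjoint G ρ)
    (hτ : FormSelfAdjoint G τ) : FormSelfAdjoint G (ρ + τ) := by
  intro v i j
  simp only [LinearMap.add_apply, MultilinearMap.map_update_add, hρ v i j, hτ v i j]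

theorem FormSelfAdjoint.smul {τ : Module.End K V} (c : K) (hτ : FormSelfAdjoint G τ) :
    FormSelfAdjoint G (c • τ) := by
  intro v i j
  simp only [LinearMap.smul_apply, MultilinearMap.map_update_smul, hτ v i j]

theorem FormSelfAdjoint.mul_of_commute {ρ τ : Module.End K V} (hρ : FormSelfAdjoint G ρ)
    (hτ : FormSelfAdjoint G τ) (h : Commute ρ τ) : FormSelfAdjoint G (ρ * τ) := by
  intro v i j
  obtain rfl | hij := eq_or_ne i j
  · rfl
  calc G (Function.update v i ((ρ * τ) (v i)))
      = G (Function.update (Function.update v i (τ (v i))) j (ρ (v j))) := by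
        simpa [hij.symm] using hρ (Function.update v i (τ (v i))) i j
    _ = G (Function.update v j ((τ * ρ) (v j))) := by
        rw [Function.update_comm hij]
        simpa [hij] using hτ (Function.update v j (ρ (v j))) i j
    _ = G (Function.update v j ((ρ * τ) (v j))) := by rw [h.eq]

theorem FormSelfAdjoint.of_mem_adjoin {ρ τ : Module.End K V} (hτ : FormSelfAdjoint G τ)
    (hρ : ρ ∈ Algebra.adjoin K {τ}) : FormSelfAdjoint G ρ := by
  induction hρ using Algebra.adjoin_induction with
  | mem x hx =>
    obtain rfl := hx
    exact hτ
  | algebraMap c =>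
    rw [Algebra.algebraMap_eq_smul_one]
    exact FormSelfAdjoint.one.smul c
  | add x y _ _ hx hy => exact hx.add hy
  | mul x y hxm hym hx hy =>
    exact hx.mul_of_commute hy
      (congrArg Subtype.val (mul_comm (⟨x, hxm⟩ : Algebra.adjoin K {τ}) ⟨y, hym⟩))

/-- A selfadjoint operator applied in several arguments can be gathered into one of them. -/
theorem FormSelfAdjoint.apply_piecewise {τ : Module.End K V} (hτ : FormSelfAdjoint G τ)
    (s : Finset (Fin n)) (v : Fin n → V) (j : Fin n) :
    G (s.piecewise (fun i => τ (v i)) v) = G (Function.update v j ((τ ^ s.card) (v j))) := by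
  induction s using Finset.induction_on generalizing v with
  | empty => simp
  | insert a s ha ih =>
    have hpow : FormSelfAdjoint G (τ ^ s.card) :=
      hτ.of_mem_adjoin (pow_mem (Algebra.self_mem_adjoin_singleton K τ) _)
    have hpow' : FormSelfAdjoint G (τ ^ (s.card + 1)) :=
      hτ.of_mem_adjoin (pow_mem (Algebra.self_mem_adjoin_singleton K τ) _)
    have hv : (insert a s).piecewise (fun i => τ (v i)) v =
        s.piecewise (fun i => τ (Function.update v a (τ (v a)) i))
          (Function.update v a (τ (v a))) := by
      ext i
      by_cases his : i ∈ s
      · have hia : i ≠ a := fun h => ha (h ▸ his)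
        simp [his, hia]
      · obtain rfl | hia := eq_or_ne i a
        · simp [ha]
        · simp [his, hia]
    rw [hv, ih, hpow _ j a, Finset.card_insert_of_notMem ha, hpow' v j a, pow_succ]
    simp

end FormSelfAdjoint

section FormSymmEquiv

variable {K : Type*} [Field K] {n : ℕ} {U V : Type*} [AddCommGroup U] [Module K U]
  [AddCommGroup V] [Module K V] {F : MultilinearMap K (fun _ : Fin n => U) K}
  {G : MultilinearMap K (fun _ : Fin n => V) K}

/-- The ratio of any two of the maps in a symmetric equivalence is selfadjoint. -/
theorem formSelfAdjoint_of_symmEquiv {φ : Fin n → U ≃ₗ[K] V}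
    (hφ : ∀ (σ : Equiv.Perm (Fin n)) (u : Fin n → U), F u = G fun i => φ (σ i) (u i))
    (a b : Fin n) : FormSelfAdjoint G ((φ b).toLinearMap ∘ₗ (φ a).symm.toLinearMap) := by
  intro v i j
  obtain rfl | hij := eq_or_ne i j
  · rfl
  obtain rfl | hab := eq_or_ne a b
  · simp
  obtain ⟨σ, hσi, hσj⟩ : ∃ σ : Equiv.Perm (Fin n), σ i = a ∧ σ j = b := by
    refine ⟨(Equiv.swap i a).trans (Equiv.swap (Equiv.swap i a j) b), ?_, by simp⟩
    have h : Equiv.swap i a j ≠ a := fun h => hij (by simpa using congrArg (Equiv.swap i a) h.symm)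
    simp [Equiv.swap_apply_of_ne_of_ne h.symm hab]
  let w : Fin n → U := Function.update (fun k => (φ (σ k)).symm (v k)) j ((φ a).symm (v j))
  have h₁ : (fun k => φ (σ k) (w k)) = Function.update v j (φ b ((φ a).symm (v j))) := by
    ext k
    obtain rfl | hk := eq_or_ne k j
    · simp [w, hσj]
    · simp [w, hk]
  have h₂ : (fun k => φ (((Equiv.swap i j).trans σ) k) (w k)) =
      Function.update v i (φ b ((φ a).symm (v i))) := by
    ext k
    obtain rfl | hkj := eq_or_ne k j
    · simp [w, hσi, hij.symm]
    · obtain rfl | hki := eq_or_ne k i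
      · simp [w, hσi, hσj, hij]
      · simp [w, hki, hkj, Equiv.swap_apply_of_ne_of_ne hki hkj]
  change G (Function.update v i (φ b ((φ a).symm (v i)))) =
    G (Function.update v j (φ b ((φ a).symm (v j))))
  rw [← h₁, ← h₂, ← hφ, ← hφ]

/-- Taking a root of the ratio of two maps of a symmetric equivalence enlarges a set of indices
on which the maps agree. -/
theorem exists_symmEquiv_eq_on_insert [IsAlgClosed K] [CharZero K] [FiniteDimensional K V]
    {φ : Fin n → U ≃ₗ[K] V}
    (hφ : ∀ (σ : Equiv.Perm (Fin n)) (u : Fin n → U), F u = G fun i => φ (σ i) (u i))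
    {s : Finset (Fin n)} {a b : Fin n} (hs : ∀ i ∈ s, φ i = φ a) :
    ∃ ψ : Fin n → U ≃ₗ[K] V, (∀ i ∈ insert b s, ψ i = ψ b) ∧
      ∀ (σ : Equiv.Perm (Fin n)) (u : Fin n → U), F u = G fun i => ψ (σ i) (u i) := by
  set τ : Module.End K V := (φ b).toLinearMap ∘ₗ (φ a).symm.toLinearMap with hτ
  have hτu : IsUnit τ := by
    rw [Module.End.isUnit_iff]
    exact (φ b).bijective.comp (φ a).symm.bijective
  have hm : (insert b s).card ≠ 0 := Finset.card_ne_zero_of_mem (Finset.mem_insert_self b s)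
  obtain ⟨ρ, hρ, hρτ⟩ := hτu.exists_mem_adjoin_pow_eq_of_isAlgClosed K
    (Algebra.IsIntegral.isIntegral τ) (Nat.cast_ne_zero.2 hm)
  have hρG : FormSelfAdjoint G ρ := (formSelfAdjoint_of_symmEquiv hφ a b).of_mem_adjoin hρ
  have hρu : IsUnit ρ := by rwa [← isUnit_pow_iff hm, hρτ]
  let χ : U ≃ₗ[K] V :=
    (φ a).trans (LinearEquiv.ofBijective ρ ((Module.End.isUnit_iff ρ).1 hρu))
  refine ⟨fun i => if i ∈ insert b s then χ else φ i, fun i hi => ?_, fun σ u => ?_⟩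
  · simp only [hi, Finset.mem_insert_self, if_true]
  let t := (insert b s).map σ.symm.toEmbedding
  have hmem : ∀ i, i ∈ t ↔ σ i ∈ insert b s := fun i => by
    simp only [t, Finset.mem_map_equiv, Equiv.symm_symm]
  let v : Fin n → V := fun i => if i ∈ t then φ a (u i) else φ (σ i) (u i)
  have hleft : (fun i => φ (σ i) (u i)) =
      Function.update v (σ.symm b) ((ρ ^ t.card) (v (σ.symm b))) := by
    have hcard : t.card = (insert b s).card := Finset.card_map _
    rw [hcard, hρτ]
    ext i
    obtain rfl | hi := eq_or_ne i (σ.symm b)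
    · simp [v, hmem, hτ]
    · have hib : σ i ≠ b := fun h => hi (by simp [← h])
      by_cases his : σ i ∈ s
      · simp [v, hi, hmem, his, hs _ his]
      · simp [v, hi, hmem, his, hib]
  have hright : (fun i => (if σ i ∈ insert b s then χ else φ (σ i)) (u i)) =
      t.piecewise (fun i => ρ (v i)) v := by
    ext i
    by_cases hi : i ∈ t
    · simp only [Finset.piecewise_eq_of_mem _ _ _ hi, v, if_pos hi, if_pos ((hmem i).1 hi)]
      rfl
    · simp only [Finset.piecewise_eq_of_notMem _ _ _ hi, v, if_neg hi,
        if_neg (mt (hmem i).2 hi)]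
  rw [hright, hρG.apply_piecewise t v (σ.symm b), ← hleft]
  exact hφ σ u

theorem FormSymmEquiv.formCongruent [IsAlgClosed K] [CharZero K] [FiniteDimensional K V]
    [NeZero n] (h : FormSymmEquiv F G) : FormCongruent F G := by
  obtain ⟨φ₀, hφ₀⟩ := h
  have agree : ∀ s : Finset (Fin n), ∃ (φ : Fin n → U ≃ₗ[K] V) (a : Fin n),
      (∀ i ∈ s, φ i = φ a) ∧
        ∀ (σ : Equiv.Perm (Fin n)) (u : Fin n → U), F u = G fun i => φ (σ i) (u i) := by
    intro s
    induction s using Finset.induction_on with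
    | empty => exact ⟨φ₀, 0, by simp, hφ₀⟩
    | insert b s _ ih =>
      obtain ⟨φ, a, hs, hφ⟩ := ih
      obtain ⟨ψ, hψ⟩ := exists_symmEquiv_eq_on_insert (b := b) hφ hs
      exact ⟨ψ, b, hψ⟩
  obtain ⟨φ, a, ha, hφ⟩ := agree Finset.univ
  refine ⟨φ a, fun u => ?_⟩
  rw [hφ 1 u]
  simp only [ha _ (Finset.mem_univ _)]

end FormSymmEquiv

/-- Two complex multilinear forms `F` and `G` are congruent iff the systems
`S(F) = {F^σ}` and `S(G) = {G^σ}` are equivalent, i.e. iff there are linear bijections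
`φ₁, …, φₙ` with `F^σ(u₁, …, uₙ) = G^σ(φ₁ u₁, …, φₙ uₙ)` for every permutation `σ`. -/
theorem stmt_9 {n : ℕ} (hn : 2 ≤ n) {U V : Type*}
    [AddCommGroup U] [Module ℂ U] [FiniteDimensional ℂ U]
    [AddCommGroup V] [Module ℂ V] [FiniteDimensional ℂ V]
    (F : MultilinearMap ℂ (fun _ : Fin n => U) ℂ)
    (G : MultilinearMap ℂ (fun _ : Fin n => V) ℂ) :
    FormCongruent F G ↔
      ∃ φ : Fin n → U ≃ₗ[ℂ] V, ∀ (σ : Equiv.Perm (Fin n)) (u : Fin n → U),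
        F (fun i => u (σ i)) = G fun i => φ (σ i) (u (σ i)) := by
  have : NeZero n := ⟨by omega⟩
  constructor
  · rintro ⟨φ, hφ⟩
    exact ⟨fun _ => φ, fun σ u => hφ fun i => u (σ i)⟩
  · rintro ⟨φ, hφ⟩
    refine FormSymmEquiv.formCongruent ⟨φ, fun σ u => ?_⟩
    simpa using hφ σ fun i => u (σ⁻¹ i)
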